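/- A generalised $\{R,S\}$-arrival instance in simple form consists of a finite directed graph $(V,E)$, a start vertex $s\in V$, a target $t\in V$ and a dead-end vertex $d\neq t$, a partition of $V\setminus\{t,d\}$ into random vertices $V_R$ and switching vertices $V_S$, and for each $v\in V_S$ an ordered pair $\mathrm{Ord}(v)=(s_0(v),s_1(v))$, such that: the only out-edge of $t$ is $(t,t)$ and the only out-edge of $d$ is $(d,d)$; every other vertex has exactly two out-neighbours and no self-loop; for $v\in V_S$ the two out-neighbours are $s_0(v)\neq s_1(v)$. A play starts at $s$ with all switching positions equal to $0$ (write $q_0$ for this position). From a random vertex it moves to each of the two out-neighbours with probability $1/2$; from a switching vertex $v$ with current position $q(v)\in\{0,1\}$ it moves to $s_{q(v)}(v)$, and $q(v)$ is replaced by $1-q(v)$; at $t$ and $d$ it stays forever. An edge $(v,w)\in E$ is called dead if there is no directed path (possibly of length $0$) from $w$ to $t$. Let $G$ be an $\{R,S\}$-instance in simple form with target $t$ and dead-end vertex $d$ in which every dead edge leads to $d$, i.e. $w=d$ for every dead edge $(v,w)\in E$. Then with probability $1$ the play started at $(s,q_0)$ eventually reaches $t$ or $d$. -/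

import Mathlib

open MeasureTheory ProbabilityTheory

universe u

/-- The four types of non-terminal vertices. -/
inductive NodeType where
  | random
  | switching
  | maxPlayer
  | minPlayer

/-- A generalised arrival instance on the vertex set `V`. The partition into node types is given by
`type`: the classes `V_R`, `V_S`, `V_1`, `V_2` are the fibres over the four values `some _`. The
target has no type; a dead end may be left without a type too, and an untyped vertex always has
its self-loop as its only out-edge. -/
structure ArrivalInstance (V : Type u) where
  /-- `E v w` means that `(v, w)` is an edge. -/
  E : V → V → Prop
  exists_edge : ∀ v, ∃ w, E v w
  start : V
  target : V
  type : V → Option NodeType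
  type_target : type target = none
  edge_of_untyped : ∀ v, type v = none → ∀ w, E v w ↔ w = v
  /-- Transition probabilities; only the values at random vertices are used. -/
  P : V → PMF V
  P_support : ∀ v, type v = some .random → ∀ w, w ∈ (P v).support ↔ E v w
  /-- Switching orders; only the values at switching vertices are used. -/
  ord : V → List V
  mem_ord : ∀ v, type v = some .switching → ∀ w, w ∈ ord v ↔ E v w

namespace ArrivalInstance

variable {V : Type u} (G : ArrivalInstance V)

/-- The type `V_S` of switching vertices. -/
abbrev SwitchVertex : Type u := {v : V // G.type v = some .switching}

/-- Switching positions `q`: for each switching vertex `u` an index `q u < |Ord u|`. -/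
abbrev Position : Type u := (u : G.SwitchVertex) → Fin (G.ord u.1).length

/-- States `(v, q)`. -/
abbrev State : Type u := V × G.Position

instance : MeasurableSpace G.State := ⊤

theorem ord_length_pos (u : G.SwitchVertex) : 0 < (G.ord u.1).length := by
  obtain ⟨w, hw⟩ := G.exists_edge u.1
  exact List.length_pos_of_mem ((G.mem_ord u.1 u.2 w).2 hw)

/-- The initial switching position, constantly `0`. -/
def q₀ : G.Position := fun u => ⟨0, G.ord_length_pos u⟩

open Classical in
/-- The position after leaving the switching vertex `u`: the index of `u` is incremented cyclically
and all others are unchanged. -/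
noncomputable def advance (q : G.Position) (u : G.SwitchVertex) : G.Position :=
  Function.update q u ⟨((q u : ℕ) + 1) % (G.ord u.1).length, Nat.mod_lt _ (G.ord_length_pos u)⟩

open Classical in
/-- The one-step transition law of the Markov chain on states of an instance without player
vertices. The last case is the self-loop at an untyped vertex; its value at player vertices is
irrelevant, as there are none. -/
noncomputable def step (x : G.State) : PMF G.State :=
  if hS : G.type x.1 = some .switching then
    PMF.pure ((G.ord x.1).get (x.2 ⟨x.1, hS⟩), G.advance x.2 ⟨x.1, hS⟩)
  else if G.type x.1 = some .random then
    (G.P x.1).map fun w => (w, x.2)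
  else
    PMF.pure x

/-- The transition kernel: the next state depends on the past through the current state only. -/
noncomputable def stepKernel (n : ℕ) :
    Kernel ((i : Finset.Iic n) → (fun _ : ℕ => G.State) i) G.State where
  toFun h := (G.step (h ⟨n, Finset.mem_Iic.2 le_rfl⟩)).toMeasure
  measurable' :=
    (measurable_from_top (f := fun x : G.State => (G.step x).toMeasure)).comp
      (measurable_pi_apply (⟨n, Finset.mem_Iic.2 le_rfl⟩ : Finset.Iic n))

instance (n : ℕ) : IsMarkovKernel (G.stepKernel n) where
  isProbabilityMeasure h :=
    PMF.toMeasure.isProbabilityMeasure (G.step (h ⟨n, Finset.mem_Iic.2 le_rfl⟩))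

/-- The law, on infinite sequences of states, of the play started at `(s, q₀)`:
the trajectory measure of the transition kernel with that state at time `0`. -/
noncomputable def playMeasure : Measure (ℕ → G.State) :=
  Kernel.traj (X := fun _ => G.State) G.stepKernel 0 fun _ => (G.start, G.q₀)

instance : IsProbabilityMeasure G.playMeasure := by
  unfold playMeasure; infer_instance

/-- An `{R,S}`-instance: there are no player vertices. -/
def IsRS : Prop :=
  ∀ v, G.type v ≠ some .maxPlayer ∧ G.type v ≠ some .minPlayer

/-- `G` is in simple form with dead-end vertex `d`. -/
structure IsSimpleForm (d : V) : Prop where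
  ne_target : d ≠ G.target
  edge_deadEnd : ∀ w, G.E d w ↔ w = d
  outDegree : ∀ v, v ≠ G.target → v ≠ d → {w | G.E v w}.ncard = 2
  no_selfLoop : ∀ v, v ≠ G.target → v ≠ d → ¬ G.E v v
  random : ∀ v, v ≠ d → G.type v = some .random → ∀ w, G.E v w → G.P v w = 1 / 2
  switching : ∀ v, v ≠ d → G.type v = some .switching → (G.ord v).length = 2 ∧ (G.ord v).Nodup

/-- A vertex of an instance without min-player vertices is hopeful if there is a directed path
(possibly of length `0`) from it to the target. -/
def Hopeful (v : V) : Prop := Relation.ReflTransGen G.E v G.target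

/-- An edge `(v, w)` is dead if `w` is not hopeful. -/
def DeadEdge (v w : V) : Prop := G.E v w ∧ ¬ G.Hopeful w

end ArrivalInstance

open Filter Topology

/-! ### Absorption in finite Markov chains -/

section Absorption

variable {X : Type*} [Fintype X]

/-- The averaging operator of a finite Markov chain. -/
noncomputable def PMF.average (p : X → PMF X) (f : X → ℝ) (x : X) : ℝ :=
  ∑ y, (p x y).toReal * f y

theorem PMF.sum_toReal_eq_one (p : PMF X) : ∑ y, (p y).toReal = 1 := by
  rw [← ENNReal.toReal_sum fun y _ => p.apply_ne_top y, ← tsum_fintype (L := .unconditional X),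
    p.tsum_coe, ENNReal.toReal_one]

theorem PMF.average_mono (p : X → PMF X) : Monotone (PMF.average p) := fun _ _ h _ =>
  Finset.sum_le_sum fun y _ => mul_le_mul_of_nonneg_left (h y) ENNReal.toReal_nonneg

theorem PMF.average_const (p : X → PMF X) (c : ℝ) (x : X) :
    PMF.average p (fun _ => c) x = c := by
  rw [PMF.average, ← Finset.sum_mul, PMF.sum_toReal_eq_one, one_mul]

/-- The maximum principle: at a maximum of a harmonic function, all successors are maxima. -/
theorem PMF.eq_of_average_eq_of_max {p : X → PMF X} {f : X → ℝ} {x y : X}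
    (hf : PMF.average p f x = f x) (hx : ∀ z, f z ≤ f x) (hy : y ∈ (p x).support) :
    f y = f x := by
  have hsum : ∑ z, (p x z).toReal * (f x - f z) = 0 := by
    have h1 := PMF.average_const p (f x) x
    unfold PMF.average at hf h1
    simp only [mul_sub, Finset.sum_sub_distrib]
    rw [h1, hf, sub_self]
  have h0 := (Finset.sum_eq_zero_iff_of_nonneg fun z _ =>
    mul_nonneg ENNReal.toReal_nonneg (sub_nonneg.2 (hx z))).1 hsum y (Finset.mem_univ y)
  have hne : (p x y).toReal ≠ 0 :=
    ENNReal.toReal_ne_zero.2 ⟨(PMF.mem_support_iff _ _).1 hy, (p x).apply_ne_top y⟩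
  have := (mul_eq_zero.1 h0).resolve_left hne
  linarith

/-- In a finite Markov chain, the probability of being outside a closed set that can be
reached from every state tends to zero. -/
theorem PMF.tendsto_average_iterate_indicator_compl (p : X → PMF X) (A : Set X)
    (hclosed : ∀ x ∈ A, ∀ y ∈ (p x).support, y ∈ A)
    (hreach : ∀ x, ∃ y ∈ A, Relation.ReflTransGen (fun x y => y ∈ (p x).support) x y) (x : X) :
    Tendsto (fun n => (PMF.average p)^[n] (Aᶜ.indicator 1) x) atTop (𝓝 0) := by
  classical
  set f : X → ℝ := Aᶜ.indicator 1 with hf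
  have hf1 : f ≤ fun _ => 1 := fun z => by
    by_cases hz : z ∈ A <;> simp [hf, hz]
  have hf0 : (fun _ => 0 : X → ℝ) ≤ f := fun z => by
    by_cases hz : z ∈ A <;> simp [hf, hz]
  have hle : PMF.average p f ≤ f := by
    intro z
    by_cases hz : z ∈ A
    · have hfz : f z = 0 := by simp [hf, hz]
      rw [hfz]
      refine (Finset.sum_eq_zero fun y _ => ?_).le
      by_cases hy : y ∈ (p z).support
      · have : f y = 0 := by simp [hf, hclosed z hz y hy]
        rw [this, mul_zero]
      · rw [(PMF.apply_eq_zero_iff _ _).2 hy, ENNReal.toReal_zero, zero_mul]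
    · have hfz : f z = 1 := by simp [hf, hz]
      rw [hfz, ← PMF.average_const p 1 z]
      exact PMF.average_mono p hf1 z
  have hanti := (PMF.average_mono p).antitone_iterate_of_map_le hle
  have hnonneg : ∀ n z, 0 ≤ (PMF.average p)^[n] f z := by
    intro n
    induction n with
    | zero => exact hf0
    | succ n ih =>
      intro z
      rw [Function.iterate_succ_apply', ← PMF.average_const p 0 z]
      exact PMF.average_mono p ih z
  have htend : ∀ z, Tendsto (fun n => (PMF.average p)^[n] f z) atTop
      (𝓝 (⨅ n, (PMF.average p)^[n] f z)) := fun z =>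
    tendsto_atTop_ciInf (fun m n hmn => hanti hmn z) ⟨0, by rintro _ ⟨n, rfl⟩; exact hnonneg n z⟩
  set h : X → ℝ := fun z => ⨅ n, (PMF.average p)^[n] f z with hh
  have hharm : ∀ z, PMF.average p h z = h z := by
    intro z
    refine tendsto_nhds_unique ?_ ((tendsto_add_atTop_iff_nat 1).2 (htend z))
    simp only [Function.iterate_succ_apply']
    exact tendsto_finsetSum _ fun y _ => (htend y).const_mul _
  have hA : ∀ z ∈ A, h z = 0 := by
    intro z hz
    refine le_antisymm ?_ (ge_of_tendsto' (htend z) fun n => hnonneg n z)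
    have h0 : f z = 0 := by simp [hf, hz]
    rw [← h0]
    exact le_of_tendsto' (htend z) fun n => hanti (Nat.zero_le n) z
  have : Nonempty X := ⟨x⟩
  obtain ⟨m, hm⟩ := Finite.exists_max h
  obtain ⟨a, ha, hma⟩ := hreach m
  have hconst : h a = h m := by
    clear ha
    induction hma with
    | refl => rfl
    | tail _ hbc ih =>
      exact (PMF.eq_of_average_eq_of_max (hharm _) (fun z => ih ▸ hm z) hbc).trans ih
  have hx : h x = 0 :=
    le_antisymm ((hm x).trans (by rw [← hconst, hA a ha]))
      (ge_of_tendsto' (htend x) fun n => hnonneg n x)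
  have := htend x
  rwa [show (⨅ n, (PMF.average p)^[n] f x) = 0 from hx] at this

end Absorption

/-- Every element of a finite type has a recurrent successor under the reflexive transitive
closure of a relation. -/
theorem Relation.ReflTransGen.exists_recurrent {X : Type*} [Finite X] (r : X → X → Prop) (x : X) :
    ∃ y, Relation.ReflTransGen r x y ∧
      ∀ z, Relation.ReflTransGen r y z → Relation.ReflTransGen r z y := by
  let : Preorder X :=
    { le := fun a b => Relation.ReflTransGen r b a
      le_refl := fun _ => .refl
      le_trans := fun _ _ _ hab hbc => hbc.trans hab }
  obtain ⟨y, hy⟩ := (Set.toFinite {y | Relation.ReflTransGen r x y}).exists_minimal ⟨x, .refl⟩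
  exact ⟨y, hy.1, fun z hz => hy.2 (hy.1.trans hz) hz⟩

namespace ArrivalInstance

variable {V : Type u} (G : ArrivalInstance V)

/-- `G.Reach x y`: the play moves from `x` to `y` with positive probability. -/
abbrev Reach : G.State → G.State → Prop :=
  Relation.ReflTransGen fun x y => y ∈ (G.step x).support

variable {G}

theorem mem_support_step_of_switching {x y : G.State} (hS : G.type x.1 = some .switching) :
    y ∈ (G.step x).support ↔
      y = ((G.ord x.1).get (x.2 ⟨x.1, hS⟩), G.advance x.2 ⟨x.1, hS⟩) := by
  rw [step, dif_pos hS, PMF.mem_support_pure_iff]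

theorem mem_support_step_of_random {x y : G.State} (hR : G.type x.1 = some .random) :
    y ∈ (G.step x).support ↔ G.E x.1 y.1 ∧ y.2 = x.2 := by
  rw [step, dif_neg (by simp [hR]), if_pos hR, PMF.mem_support_map_iff]
  constructor
  · rintro ⟨w, hw, rfl⟩
    exact ⟨(G.P_support _ hR _).1 hw, rfl⟩
  · rintro ⟨hE, h⟩
    exact ⟨y.1, (G.P_support _ hR _).2 hE, Prod.ext rfl h.symm⟩

theorem mem_support_step_of_untyped {x y : G.State} (hx : G.type x.1 = none) :
    y ∈ (G.step x).support ↔ y = x := by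
  rw [step, dif_neg (by simp [hx]), if_neg (by simp [hx]), PMF.mem_support_pure_iff]

theorem IsRS.type_cases (hRS : G.IsRS) (v : V) :
    G.type v = none ∨ G.type v = some .random ∨ G.type v = some .switching := by
  have := hRS v
  rcases h : G.type v with _ | (_ | _ | _ | _) <;> simp_all

theorem IsRS.edge_of_mem_support_step (hRS : G.IsRS) {x y : G.State}
    (h : y ∈ (G.step x).support) : G.E x.1 y.1 := by
  rcases hRS.type_cases x.1 with hx | hx | hx
  · rw [mem_support_step_of_untyped hx] at h
    rw [h, G.edge_of_untyped _ hx]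
  · exact ((mem_support_step_of_random hx).1 h).1
  · rw [mem_support_step_of_switching hx] at h
    rw [h, ← G.mem_ord _ hx]
    exact List.get_mem _ _

/-- The position at a switching vertex only changes when the play leaves that vertex. -/
theorem IsRS.position_eq_of_mem_support_step (hRS : G.IsRS) {x y : G.State}
    (h : y ∈ (G.step x).support) {u : G.SwitchVertex} (hu : x.1 ≠ u.1) : y.2 u = x.2 u := by
  rcases hRS.type_cases x.1 with hx | hx | hx
  · rw [(mem_support_step_of_untyped hx).1 h]
  · rw [((mem_support_step_of_random hx).1 h).2]
  · rw [(mem_support_step_of_switching hx).1 h]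
    classical
    exact Function.update_of_ne (fun h' => hu (congrArg Subtype.val h').symm) _ _

/-- If the position at `u` changes along a play, then the play visits `u` with the original
position. -/
theorem IsRS.exists_visit_of_position_ne (hRS : G.IsRS) {x y : G.State} (h : G.Reach x y)
    {u : G.SwitchVertex} (hu : y.2 u ≠ x.2 u) :
    ∃ z, G.Reach x z ∧ z.1 = u.1 ∧ z.2 u = x.2 u := by
  induction h using Relation.ReflTransGen.head_induction_on with
  | refl => exact absurd rfl hu
  | @head a b hab _ ih =>
    by_cases ha : a.1 = u.1
    · exact ⟨a, .refl, ha, rfl⟩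
    · have hpos := hRS.position_eq_of_mem_support_step hab ha
      obtain ⟨z, hbz, hz, hzu⟩ := ih (by rwa [hpos])
      exact ⟨z, .head hab hbz, hz, hzu.trans hpos⟩

theorem exists_mem_support_step_of_get {x : G.State} {u : G.SwitchVertex} (hx : x.1 = u.1) :
    ∃ y ∈ (G.step x).support, y.1 = (G.ord u.1).get (x.2 u) ∧ y.2 = G.advance x.2 u := by
  obtain ⟨v, q⟩ := x
  obtain ⟨v', hv⟩ := u
  obtain rfl : v = v' := hx
  exact ⟨_, (mem_support_step_of_switching (x := (v, q)) hv).2 rfl, rfl, rfl⟩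

/-- From a recurrent state, the vertices visited are closed under edges, away from the target and
the dead end. -/
theorem IsSimpleForm.exists_reach_of_edge {d : V} (hSF : G.IsSimpleForm d) (hRS : G.IsRS)
    {x y : G.State} (hrec : ∀ z, G.Reach x z → G.Reach z x) (hxy : G.Reach x y)
    (hyd : y.1 ≠ d) {w : V} (hw : G.E y.1 w) : ∃ z, G.Reach x z ∧ z.1 = w := by
  rcases hRS.type_cases y.1 with hy | hy | hy
  · exact ⟨y, hxy, ((G.edge_of_untyped _ hy _).1 hw).symm⟩
  · exact ⟨(w, y.2), hxy.tail ((mem_support_step_of_random hy).2 ⟨hw, rfl⟩), rfl⟩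
  · set u : G.SwitchVertex := ⟨y.1, hy⟩
    obtain ⟨i, hi⟩ := List.get_of_mem ((G.mem_ord _ hy w).2 hw)
    obtain ⟨z, hyz, hz, hzq⟩ := exists_mem_support_step_of_get (x := y) (u := u) rfl
    by_cases hq : y.2 u = i
    · exact ⟨z, hxy.tail hyz, by rw [hz, hq]; exact hi⟩
    · have hlen : (G.ord u.1).length = 2 := (hSF.switching _ hyd hy).1
      have hzi : z.2 u = i := by
        have h1 : (y.2 u : ℕ) < 2 := hlen ▸ (y.2 u).isLt
        have h2 : (i : ℕ) < 2 := hlen ▸ i.isLt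
        have h3 : (y.2 u : ℕ) ≠ i := fun h => hq (Fin.ext h)
        apply Fin.ext
        rw [hzq]
        simp only [advance, Function.update_self]
        have h4 : ∀ k, k = 2 → ((y.2 u : ℕ) + 1) % k = i := by rintro _ rfl; omega
        exact h4 _ hlen
      have hxz := hxy.tail hyz
      obtain ⟨a, hza, ha, hai⟩ := hRS.exists_visit_of_position_ne ((hrec z hxz).trans hxy)
        (u := u) (by rw [hzi]; exact hq)
      obtain ⟨b, hab, hb, -⟩ := exists_mem_support_step_of_get ha
      exact ⟨b, (hxz.trans hza).tail hab, by rw [hb, hai, hzi]; exact hi⟩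

/-- If all dead edges lead to the dead end, then every other vertex is hopeful. -/
theorem IsSimpleForm.hopeful {d : V} (hSF : G.IsSimpleForm d)
    (hdead : ∀ v w, G.DeadEdge v w → w = d) {v : V} (hv : v ≠ d) : G.Hopeful v := by
  by_contra hn
  have ht : v ≠ G.target := fun h => hn (h ▸ .refl)
  have hsub : {w | G.E v w} ⊆ {d} := fun w hw => hdead v w ⟨hw, fun h => hn (.head hw h)⟩
  have := Set.ncard_le_ncard hsub
  rw [hSF.outDegree v ht hv, Set.ncard_singleton] at this
  omega

/-- From every state, the target or the dead end is reached with positive probability. -/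
theorem IsSimpleForm.exists_reach_terminal [Finite V] {d : V} (hSF : G.IsSimpleForm d)
    (hRS : G.IsRS) (hdead : ∀ v w, G.DeadEdge v w → w = d) (x : G.State) :
    ∃ y : G.State, (y.1 = G.target ∨ y.1 = d) ∧ G.Reach x y := by
  obtain ⟨y, hxy, hrec⟩ := Relation.ReflTransGen.exists_recurrent _ x
  by_cases hd : ∃ z, G.Reach y z ∧ z.1 = d
  · obtain ⟨z, hyz, hz⟩ := hd
    exact ⟨z, .inr hz, hxy.trans hyz⟩
  push Not at hd
  have key : ∀ v, Relation.ReflTransGen G.E y.1 v → ∃ z, G.Reach y z ∧ z.1 = v := by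
    intro v hv
    induction hv with
    | refl => exact ⟨y, .refl, rfl⟩
    | tail _ hbc ih =>
      obtain ⟨z, hyz, rfl⟩ := ih
      exact hSF.exists_reach_of_edge hRS hrec hyz (hd z hyz) hbc
  obtain ⟨z, hyz, hz⟩ := key _ (hSF.hopeful hdead (hd y .refl))
  exact ⟨z, .inl hz, hxy.trans hyz⟩

variable (G)

theorem integral_playMeasure_succ [Finite V] [Fintype G.State] (f : G.State → ℝ) (n : ℕ) :
    ∫ π, f (π (n + 1)) ∂G.playMeasure = ∫ π, PMF.average G.step f (π n) ∂G.playMeasure := by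
  have hlaw := Kernel.partialTraj_compProd_eq_map_traj (X := fun _ => G.State)
    (κ := G.stepKernel) (Nat.zero_le n) (x₀ := fun _ => (G.start, G.q₀))
  have hmeas : Measurable fun π : ℕ → G.State => (Preorder.frestrictLe n π, π (n + 1)) := by
    fun_prop
  have hf : Measurable f := measurable_from_top
  have hbdd : ∃ C, ∀ z, ‖f z‖ ≤ C := by
    obtain ⟨C, hC⟩ := (Set.finite_range fun z => ‖f z‖).bddAbove
    exact ⟨C, fun z => hC ⟨z, rfl⟩⟩
  obtain ⟨C, hC⟩ := hbdd
  have hint : Integrable (fun z : (Finset.Iic n → G.State) × G.State => f z.2)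
      (Kernel.partialTraj (X := fun _ => G.State) G.stepKernel 0 n
        (fun _ => (G.start, G.q₀)) ⊗ₘ G.stepKernel n) :=
    .of_bound (hf.comp measurable_snd).aestronglyMeasurable C (ae_of_all _ fun z => hC _)
  have hstep : ∀ h : Finset.Iic n → G.State, ∫ y, f y ∂(G.stepKernel n h) =
      PMF.average G.step f (h ⟨n, Finset.mem_Iic.2 le_rfl⟩) := fun h =>
    PMF.integral_eq_sum _ _
  have hlast : Measurable fun h : Finset.Iic n → G.State =>
      PMF.average G.step f (h ⟨n, Finset.mem_Iic.2 le_rfl⟩) :=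
    (measurable_from_top (f := PMF.average G.step f)).comp (measurable_pi_apply _)
  calc ∫ π, f (π (n + 1)) ∂G.playMeasure
      = ∫ z, f z.2 ∂(G.playMeasure.map
          fun π : ℕ → G.State => (Preorder.frestrictLe n π, π (n + 1))) :=
        (integral_map hmeas.aemeasurable (hf.comp measurable_snd).aestronglyMeasurable).symm
    _ = ∫ h : Finset.Iic n → G.State, ∫ y, f y ∂(G.stepKernel n h)
          ∂(Kernel.partialTraj (X := fun _ => G.State) G.stepKernel 0 n
            fun _ => (G.start, G.q₀)) := by
        rw [playMeasure, ← hlaw, Measure.integral_compProd hint]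
    _ = ∫ π, PMF.average G.step f (π n) ∂G.playMeasure := by
        simp_rw [hstep]
        rw [← Kernel.traj_map_frestrictLe_apply, integral_map
          (Preorder.measurable_frestrictLe n).aemeasurable hlast.aestronglyMeasurable]
        rfl

theorem integral_playMeasure [Finite V] [Fintype G.State] (f : G.State → ℝ) (n : ℕ) :
    ∫ π, f (π n) ∂G.playMeasure = (PMF.average G.step)^[n] f (G.start, G.q₀) := by
  induction n generalizing f with
  | zero =>
    have hlast : Measurable fun h : Finset.Iic 0 → G.State => f (h ⟨0, Finset.mem_Iic.2 le_rfl⟩) :=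
      (measurable_from_top (f := f)).comp (measurable_pi_apply _)
    calc ∫ π, f (π 0) ∂G.playMeasure
        = ∫ h : Finset.Iic 0 → G.State, f (h ⟨0, Finset.mem_Iic.2 le_rfl⟩)
            ∂(G.playMeasure.map (Preorder.frestrictLe 0)) :=
          (integral_map (Preorder.measurable_frestrictLe (X := fun _ => G.State) 0).aemeasurable
            hlast.aestronglyMeasurable).symm
      _ = f (G.start, G.q₀) := by
          rw [playMeasure, Kernel.traj_map_frestrictLe_apply, Kernel.partialTraj_self,
            Kernel.id_apply, integral_dirac' _ _ hlast.stronglyMeasurable]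
  | succ n ih => rw [integral_playMeasure_succ, ih, Function.iterate_succ_apply]

end ArrivalInstance

theorem stmt_6 {V : Type u} [Finite V] (G : ArrivalInstance V) (d : V)
    (hRS : G.IsRS) (hSF : G.IsSimpleForm d)
    (hdead : ∀ v w, G.DeadEdge v w → w = d) :
    ∀ᵐ π ∂G.playMeasure, ∃ n : ℕ, (π n).1 = G.target ∨ (π n).1 = d := by
  classical
  have : Fintype G.State := Fintype.ofFinite _
  set A : Set G.State := {x | x.1 = G.target ∨ x.1 = d} with hA
  have hclosed : ∀ x ∈ A, ∀ y ∈ (G.step x).support, y ∈ A := by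
    intro x hx y hy
    have hE := hRS.edge_of_mem_support_step hy
    rcases hx with hx | hx <;> rw [hx] at hE
    · exact .inl ((G.edge_of_untyped _ G.type_target _).1 hE)
    · exact .inr ((hSF.edge_deadEnd _).1 hE)
  have htend := PMF.tendsto_average_iterate_indicator_compl G.step A hclosed
    (hSF.exists_reach_terminal hRS hdead) (G.start, G.q₀)
  have hreal : ∀ n, G.playMeasure.real {π | π n ∉ A} =
      (PMF.average G.step)^[n] (Aᶜ.indicator 1) (G.start, G.q₀) := by
    intro n
    rw [← G.integral_playMeasure]
    have hm : MeasurableSet {π : ℕ → G.State | π n ∉ A} :=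
      (measurable_pi_apply n : Measurable fun π : ℕ → G.State => π n)
        (MeasurableSpace.measurableSet_top : MeasurableSet Aᶜ)
    exact (integral_indicator_one hm).symm
  have hzero : G.playMeasure.real {π | ¬ ∃ n, (π n).1 = G.target ∨ (π n).1 = d} = 0 := by
    refine le_antisymm (ge_of_tendsto' htend fun n => ?_) measureReal_nonneg
    rw [← hreal]
    exact measureReal_mono fun π hπ hn => hπ ⟨n, hn⟩
  rw [ae_iff]
  exact (measureReal_eq_zero_iff).1 hzero
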